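/- arXiv:2105.01512 — 6 statements merged into one kernel-verified Lean document; each statement's English description precedes it below -/
import Mathlib

section
/- Let T1 and T2 be Σ_I/Σ_O transducers and let Λ ⊆ Σ_I^* be a language. If there exist k1, k2 > 0 such that T1 ≺_{k1,Λ} T2 and T2 ≺_{k2,Λ} T1, then T1 ≡_{k1·k2,Λ} T2. -/
/-- A `Σ_I/Σ_O` transducer: states `Q`, initial state, transition function and labelling. -/
structure Transducer (I O Q : Type*) where
  init : Q
  step : Q → I → Q
  label : Q → O

namespace Transducer

variable {I O Q : Type*}

/-- The output of the transducer read from state `q` (the label of `q` itself is ignored). -/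
def outFrom (T : Transducer I O Q) : Q → List I → List O
  | _, [] => []
  | q, a :: x => T.label (T.step q a) :: T.outFrom (T.step q a) x

/-- The output `T(x)` of the transducer on the word `x`. -/
def out (T : Transducer I O Q) (x : List I) : List O :=
  T.outFrom T.init x

end Transducer

/-- `x ≈_k y` : the words have equal length and, for every `r`, the `r`-th `k`-round of `y`
is a permutation of the `r`-th `k`-round of `x` (equal Parikh vectors / letter multisets). -/
def RoundEquiv {α : Type*} (k : ℕ) (x y : List α) : Prop :=
  x.length = y.length ∧
    ∀ r : ℕ, (↑((x.drop (k * r)).take k) : Multiset α) = ↑((y.drop (k * r)).take k)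

/-- `T₂` `k`-round simulates `T₁` restricted to `Λ` (written `T₁ ≺_{k,Λ} T₂`). -/
def RoundSim {I O Q₁ Q₂ : Type*} (k : ℕ) (T₁ : Transducer I O Q₁) (T₂ : Transducer I O Q₂)
    (Λ : Set (List I)) : Prop :=
  ∀ x ∈ Λ, k ∣ x.length →
    ∃ x' : List I, RoundEquiv k x x' ∧ RoundEquiv k (T₁.out x) (T₂.out x')

/-- `T₁ ≡_{k,Λ} T₂` : mutual `k`-round simulation restricted to `Λ`. -/
def RoundEquivT {I O Q₁ Q₂ : Type*} (k : ℕ) (T₁ : Transducer I O Q₁) (T₂ : Transducer I O Q₂)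
    (Λ : Set (List I)) : Prop :=
  RoundSim k T₁ T₂ Λ ∧ RoundSim k T₂ T₁ Λ

/-- The trace DFA `Tr(T)` of a transducer: states `Option Q`, with `none` the rejecting
sink `q_⊥`; all states of `Q` are accepting. -/
def Transducer.trace {I O Q : Type*} [DecidableEq O] (T : Transducer I O Q) :
    DFA (I × O) (Option Q) where
  step := fun q a => q.bind fun q' =>
    if T.label (T.step q' a.1) = a.2 then some (T.step q' a.1) else none
  start := some T.init
  accept := {q | q.isSome}

/-- The permutation-closure NFA `Perm_k(N)`. Letters are pairs `(α, β)` of a length-`k`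
input block and a length-`k` output block; a step on `(α,β)` may follow `N` on any word
`(α',β')` obtained by permuting `α` and `β`. -/
def permNFA {I O S : Type*} (N : NFA (I × O) S) (k : ℕ) : NFA (List I × List O) S where
  step := fun s a =>
    {t | a.1.length = k ∧ a.2.length = k ∧
      ∃ (α : List I) (β : List O), (↑α : Multiset I) = ↑a.1 ∧ (↑β : Multiset O) = ↑a.2 ∧
        t ∈ N.evalFrom {s} (α.zip β)}
  start := N.start
  accept := N.accept

/-- The type `τ_A(w)` of a word `w` in an NFA `A`: the Boolean matrix (here, a relation)
recording which pairs of states are connected by a run on `w`. -/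
def NFA.wordType {α S : Type*} (N : NFA α S) (w : List α) : S → S → Prop :=
  fun s t => t ∈ N.evalFrom {s} w

/-- The type `τ_N(p,o)` of a pair of Parikh vectors (represented as multisets), defined as
the type in `Perm_k(N)` of any letter `(α,β)` with `𝔓(α) = p`, `𝔓(β) = o`. -/
def vecType {I O S : Type*} (N : NFA (I × O) S) (k : ℕ) (p : Multiset I) (o : Multiset O) :
    S → S → Prop :=
  fun s t => t ∈ (permNFA N k).step s (p.toList, o.toList)

/-- The `k`-th type profile `Υ(N,k)`: the set of types of Parikh vectors of length-`k` blocks. -/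
def typeProfile {I O S : Type*} (N : NFA (I × O) S) (k : ℕ) : Set (S → S → Prop) :=
  {τ | ∃ (p : Multiset I) (o : Multiset O),
    Multiset.card p = k ∧ Multiset.card o = k ∧ vecType N k p o = τ}

/-- Letterwise action of a permutation of `P` on a word over `2^P`. -/
def permuteWord {P : Type*} (π : Equiv.Perm P) (x : List (Set P)) : List (Set P) :=
  x.map fun σ => π '' σ

/-- The permuted transducer `T^π`. -/
def Transducer.permuted {P Q : Type*} (T : Transducer (Set P) (Set P) Q) (π : Equiv.Perm P) :
    Transducer (Set P) (Set P) Q where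
  init := T.init
  step := fun q σ => T.step q (⇑π⁻¹ '' σ)
  label := fun q => π '' T.label q

/-- `T` is `k`-round symmetric with respect to the permutation `π`. -/
def RoundSymmetricWrt {P Q : Type*} (T : Transducer (Set P) (Set P) Q) (π : Equiv.Perm P)
    (k : ℕ) : Prop :=
  ∀ x : List (Set P), k ∣ x.length →
    ∃ x' : List (Set P), RoundEquiv k (permuteWord π x) x' ∧
      RoundEquiv k (permuteWord π (T.out x)) (T.out x')

/-- Any block of `m` consecutive rounds is a permutation of the corresponding block. -/
theorem RoundEquiv.perm_take_drop {α : Type*} {k : ℕ} {x y : List α} (h : RoundEquiv k x y)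
    (s m : ℕ) : ((x.drop (k * s)).take (k * m)).Perm ((y.drop (k * s)).take (k * m)) := by
  induction m with
  | zero => simp
  | succ m ih =>
    have hr := Multiset.coe_eq_coe.mp (h.2 (s + m))
    rw [Nat.mul_add] at hr
    rw [Nat.mul_succ, List.take_add, List.take_add, List.drop_drop, List.drop_drop]
    exact ih.append hr

/-- Round equivalence passes to multiples of the round length. -/
theorem RoundEquiv.mul_right {α : Type*} {k : ℕ} {x y : List α} (h : RoundEquiv k x y)
    (m : ℕ) : RoundEquiv (k * m) x y := by
  refine ⟨h.1, fun r => Multiset.coe_eq_coe.mpr ?_⟩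
  rw [Nat.mul_assoc]
  exact h.perm_take_drop (m * r) m

/-- Round simulation passes to multiples of the round length. -/
theorem RoundSim.mul_right {I O Q₁ Q₂ : Type*} {k : ℕ} {T₁ : Transducer I O Q₁}
    {T₂ : Transducer I O Q₂} {Λ : Set (List I)} (h : RoundSim k T₁ T₂ Λ) (m : ℕ) :
    RoundSim (k * m) T₁ T₂ Λ := by
  intro x hx hd
  obtain ⟨x', hin, hout⟩ := h x hx (dvd_of_mul_right_dvd hd)
  exact ⟨x', hin.mul_right m, hout.mul_right m⟩

/-- if `T₁ ≺_{k₁,Λ} T₂` and `T₂ ≺_{k₂,Λ} T₁` then `T₁ ≡_{k₁·k₂,Λ} T₂`. -/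
theorem roundEquivT_of_mutual_sim {I O Q₁ Q₂ : Type*}
    (T₁ : Transducer I O Q₁) (T₂ : Transducer I O Q₂) (Λ : Set (List I))
    (k₁ k₂ : ℕ) (hk₁ : 0 < k₁) (hk₂ : 0 < k₂)
    (h₁ : RoundSim k₁ T₁ T₂ Λ) (h₂ : RoundSim k₂ T₂ T₁ Λ) :
    RoundEquivT (k₁ * k₂) T₁ T₂ Λ := by
  exact ⟨h₁.mul_right k₂, Nat.mul_comm k₂ k₁ ▸ h₂.mul_right k₁⟩
end

section
/- For every NFA N over the alphabet Σ_I×Σ_O and every k > 0, L(Perm_k(N)) = {(x,y) ∈ Σ_I^* × Σ_O^* : |x| = |y| = kR for some R ∈ ℕ, and there exist x' ≈_k x and y' ≈_k y with (x',y') ∈ L(N)}. -/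
namespace List

variable {α : Type*}

theorem toChunks_go_eq_append (n : ℕ) (xs : List α) (acc₁ : Array α) (acc₂ : Array (List α)) :
    toChunks.go n xs acc₁ acc₂ = acc₂.toList ++ toChunks.go n xs acc₁ #[] := by
  induction xs generalizing acc₁ acc₂ with
  | nil => simp [toChunks.go]
  | cons x xs ih =>
    rw [toChunks.go, toChunks.go]
    split
    · rw [ih, ih _ (#[].push _)]
      simp
    · rw [ih]

theorem toChunks_go_append (n : ℕ) (l xs : List α) (acc₁ : Array α) (acc₂ : Array (List α))
    (h : acc₁.size + l.length ≤ n) :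
    toChunks.go n (l ++ xs) acc₁ acc₂ = toChunks.go n xs (acc₁ ++ l.toArray) acc₂ := by
  induction l generalizing acc₁ with
  | nil => simp
  | cons a l ih =>
    simp only [length_cons] at h
    have hne : ¬ acc₁.size = n := by lia
    rw [cons_append, toChunks.go, if_neg (by simpa using hne),
      ih _ (by simp only [Array.size_push]; lia)]
    congr 1
    apply Array.ext'
    simp

theorem toChunks_append {k : ℕ} (hk : 0 < k) {a : List α} (ha : a.length = k) (xs : List α) :
    (a ++ xs).toChunks k = a :: xs.toChunks k := by
  obtain _ | ⟨x, l⟩ := a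
  · simp at ha; lia
  obtain ⟨m, rfl⟩ : ∃ m, k = m + 1 := ⟨k - 1, by lia⟩
  simp only [length_cons, Nat.add_right_cancel_iff] at ha
  rw [cons_append, toChunks, toChunks_go_append _ _ _ _ _ (by simp; lia)]
  · cases xs with
    | nil => simp [toChunks.go, toChunks]
    | cons y ys =>
      rw [toChunks.go, if_pos (by simp; lia), toChunks_go_eq_append, toChunks]
      · simp
      · simp
  · simp

end List

theorem roundEquiv_append_iff {α : Type*} {k : ℕ} {a b : List α} (ha : a.length = k)
    (hb : b.length = k) (x y : List α) :
    RoundEquiv k (a ++ x) (b ++ y) ↔ (a : Multiset α) = b ∧ RoundEquiv k x y := by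
  have drop_succ : ∀ {c : List α}, c.length = k → ∀ (z : List α) (r : ℕ),
      (c ++ z).drop (k * (r + 1)) = z.drop (k * r) := by
    intro c hc z r
    rw [mul_add, mul_one, add_comm, ← List.drop_drop, List.drop_left' hc]
  constructor
  · rintro ⟨hl, h⟩
    refine ⟨by simpa [List.take_left' ha, List.take_left' hb] using h 0, ?_, fun r => ?_⟩
    · simp only [List.length_append] at hl
      lia
    · simpa only [drop_succ ha, drop_succ hb] using h (r + 1)
  · rintro ⟨hab, hl, h⟩
    refine ⟨by simp [ha, hb, hl], fun r => ?_⟩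
    cases r with
    | zero => simpa [List.take_left' ha, List.take_left' hb] using hab
    | succ r => simpa only [drop_succ ha, drop_succ hb] using h r

theorem RoundEquiv.refl {α : Type*} (k : ℕ) (x : List α) : RoundEquiv k x x :=
  ⟨rfl, fun _ => rfl⟩

theorem List.exists_eq_append_of_length_eq_mul_succ {α : Type*} {k R : ℕ} {x : List α}
    (h : x.length = k * (R + 1)) :
    ∃ a x₁ : List α, x = a ++ x₁ ∧ a.length = k ∧ x₁.length = k * R := by
  rw [mul_add, mul_one] at h
  exact ⟨x.take k, x.drop k, (x.take_append_drop k).symm, by simp [h], by simp [h]⟩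

theorem mem_stepSet_permNFA {I O S : Type*} {N : NFA (I × O) S} {k : ℕ} {A : Set S}
    {a : List I × List O} {t : S} :
    t ∈ (permNFA N k).stepSet A a ↔ a.1.length = k ∧ a.2.length = k ∧
      ∃ (α : List I) (β : List O), (↑α : Multiset I) = ↑a.1 ∧ (↑β : Multiset O) = ↑a.2 ∧
        t ∈ N.evalFrom A (α.zip β) := by
  simp only [NFA.mem_stepSet, NFA.mem_evalFrom_iff_exists (S := A), permNFA, Set.mem_ofPred_eq]
  constructor
  · rintro ⟨s, hs, ha, hb, α, β, hα, hβ, ht⟩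
    exact ⟨ha, hb, α, β, hα, hβ, s, hs, ht⟩
  · rintro ⟨ha, hb, α, β, hα, hβ, s, hs, ht⟩
    exact ⟨s, hs, ha, hb, α, β, hα, hβ, ht⟩

theorem mem_evalFrom_permNFA {I O S : Type*} (N : NFA (I × O) S) {k : ℕ} (hk : 0 < k)
    (w : List (List I × List O)) (A : Set S) (t : S) :
    t ∈ (permNFA N k).evalFrom A w ↔ ∃ (x : List I) (y : List O),
      w = (x.toChunks k).zip (y.toChunks k) ∧
      (∃ R : ℕ, x.length = k * R ∧ y.length = k * R) ∧
      ∃ (x' : List I) (y' : List O),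
        RoundEquiv k x x' ∧ RoundEquiv k y y' ∧ t ∈ N.evalFrom A (x'.zip y') := by
  induction w generalizing A t with
  | nil =>
    constructor
    · intro h
      exact ⟨[], [], by simp [List.toChunks], ⟨0, by simp⟩, [], [], .refl _ _, .refl _ _, h⟩
    · rintro ⟨x, y, hw, ⟨R, hx, hy⟩, x', y', hxx, hyy, ht⟩
      cases R with
      | zero =>
        have hx' : x' = [] := List.eq_nil_of_length_eq_zero (by rw [← hxx.1, hx, mul_zero])
        simpa [hx'] using ht
      | succ R =>
        obtain ⟨a, x, rfl, ha, -⟩ := List.exists_eq_append_of_length_eq_mul_succ hx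
        obtain ⟨b, y, rfl, hb, -⟩ := List.exists_eq_append_of_length_eq_mul_succ hy
        simp [List.toChunks_append hk ha, List.toChunks_append hk hb] at hw
  | cons c w ih =>
    obtain ⟨a, b⟩ := c
    rw [NFA.evalFrom_cons, NFA.mem_evalFrom_iff_exists]
    constructor
    · rintro ⟨s, hs, ht⟩
      obtain ⟨ha, hb, a', b', haa, hbb, hs⟩ := mem_stepSet_permNFA.1 hs
      obtain ⟨x, y, rfl, ⟨R, hx, hy⟩, x', y', hxx, hyy, ht⟩ := (ih _ _).1 ht
      have ha' : a'.length = k := (Multiset.coe_eq_coe.1 haa).length_eq.trans ha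
      have hb' : b'.length = k := (Multiset.coe_eq_coe.1 hbb).length_eq.trans hb
      refine ⟨a ++ x, b ++ y, ?_, ⟨R + 1, ?_, ?_⟩, a' ++ x', b' ++ y',
        (roundEquiv_append_iff ha ha' _ _).2 ⟨haa.symm, hxx⟩,
        (roundEquiv_append_iff hb hb' _ _).2 ⟨hbb.symm, hyy⟩, ?_⟩
      · rw [List.toChunks_append hk ha, List.toChunks_append hk hb, List.zip_cons_cons]
      · rw [List.length_append, ha, hx]; ring
      · rw [List.length_append, hb, hy]; ring
      · rw [List.zip_append (ha'.trans hb'.symm), NFA.evalFrom_append,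
          NFA.mem_evalFrom_iff_exists]
        exact ⟨s, hs, ht⟩
    · rintro ⟨x, y, hw, ⟨R, hx, hy⟩, x', y', hxx, hyy, ht⟩
      cases R with
      | zero =>
        rw [mul_zero, List.length_eq_zero_iff] at hx
        simp [hx, List.toChunks] at hw
      | succ R =>
        obtain ⟨a', x', rfl, ha', -⟩ :=
          List.exists_eq_append_of_length_eq_mul_succ (hxx.1.symm.trans hx)
        obtain ⟨b', y', rfl, hb', -⟩ :=
          List.exists_eq_append_of_length_eq_mul_succ (hyy.1.symm.trans hy)
        obtain ⟨a₀, x, rfl, ha, hx₁⟩ := List.exists_eq_append_of_length_eq_mul_succ hx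
        obtain ⟨b₀, y, rfl, hb, hy₁⟩ := List.exists_eq_append_of_length_eq_mul_succ hy
        rw [List.toChunks_append hk ha, List.toChunks_append hk hb, List.zip_cons_cons,
          List.cons.injEq, Prod.mk.injEq] at hw
        obtain ⟨⟨rfl, rfl⟩, hw⟩ := hw
        rw [roundEquiv_append_iff ha ha'] at hxx
        rw [roundEquiv_append_iff hb hb'] at hyy
        rw [List.zip_append (ha'.trans hb'.symm), NFA.evalFrom_append,
          NFA.mem_evalFrom_iff_exists] at ht
        obtain ⟨s, hs, ht⟩ := ht
        exact ⟨s, mem_stepSet_permNFA.2 ⟨ha, hb, a', b', hxx.1.symm, hyy.1.symm, hs⟩,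
          (ih _ _).2 ⟨x, y, hw, ⟨R, hx₁, hy₁⟩, x', y', hxx.2, hyy.2, ht⟩⟩

/-- the language of `Perm_k(N)` consists exactly of (the round encodings of)
the pairs `(x,y)` with `|x| = |y| = kR` for which some `x' ≈_k x` and `y' ≈_k y` satisfy
`(x',y') ∈ L(N)`. -/
theorem permNFA_accepts {I O S : Type*} (N : NFA (I × O) S) (k : ℕ) (hk : 0 < k) :
    (permNFA N k).accepts =
      {w : List (List I × List O) | ∃ (x : List I) (y : List O),
        w = (x.toChunks k).zip (y.toChunks k) ∧
        (∃ R : ℕ, x.length = k * R ∧ y.length = k * R) ∧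
        ∃ (x' : List I) (y' : List O),
          RoundEquiv k x x' ∧ RoundEquiv k y y' ∧ x'.zip y' ∈ N.accepts} := by
  ext w
  simp only [NFA.mem_accepts, mem_evalFrom_permNFA N hk]
  constructor
  · rintro ⟨t, ht, x, y, hw, hR, x', y', hx, hy, h⟩
    exact ⟨x, y, hw, hR, x', y', hx, hy, t, ht, h⟩
  · rintro ⟨x, y, hw, hR, x', y', hx, hy, t, ht, h⟩
    exact ⟨t, ht, x, y, hw, hR, x', y', hx, hy, h⟩
end

section
/- Let T1, T2 be Σ_I/Σ_O transducers, Λ ⊆ Σ_I^* a language, and k > 0. Let A1^k = Perm_k(D1) where D1 is an NFA recognizing L(Tr(T1)) ∩ Λ (with Λ identified with a language over Σ_I×Σ_O by ignoring the output component), and let A2^k = Perm_k(Tr(T2)). Then T1 ≺_{k,Λ} T2 if and only if L(A1^k) ⊆ L(A2^k). -/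
/-- Two words of blocks agree up to permuting both components of each block. -/
def BlockPerm {I O : Type*} (w v : List (List I × List O)) : Prop :=
  List.Forall₂ (fun a b => b.1.Perm a.1 ∧ b.2.Perm a.2) w v

theorem BlockPerm.refl {I O : Type*} (w : List (List I × List O)) : BlockPerm w w :=
  List.forall₂_same.2 fun _ _ => ⟨.refl _, .refl _⟩

theorem BlockPerm.trans {I O : Type*} {u v w : List (List I × List O)} (huv : BlockPerm u v)
    (hvw : BlockPerm v w) : BlockPerm u w := by
  induction huv generalizing w with
  | nil => exact hvw
  | cons h _ ih =>
    obtain _ | ⟨h', hvw⟩ := hvw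
    exact .cons ⟨h'.1.trans h.1, h'.2.trans h.2⟩ (ih hvw)

theorem permNFA_mem_evalFrom {I O S : Type*} (N : NFA (I × O) S) (k : ℕ)
    (w : List (List I × List O)) (A : Set S) (t : S) :
    t ∈ (permNFA N k).evalFrom A w ↔
      (∀ a ∈ w, a.1.length = k ∧ a.2.length = k) ∧
        ∃ v, BlockPerm w v ∧ t ∈ N.evalFrom A (v.flatMap fun a => a.1.zip a.2) := by
  induction w generalizing A with
  | nil => simp [BlockPerm]
  | cons a w ih =>
    rw [NFA.evalFrom_cons, ih]
    constructor
    · rintro ⟨hw, v, hv, ht⟩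
      rw [NFA.mem_evalFrom_iff_exists] at ht
      obtain ⟨s, hs, ht⟩ := ht
      obtain ⟨r, hr, h1, h2, α, β, hα, hβ, hs⟩ := NFA.mem_stepSet.1 hs
      refine ⟨List.forall_mem_cons.2 ⟨⟨h1, h2⟩, hw⟩, (α, β) :: v,
        .cons ⟨Multiset.coe_eq_coe.1 hα, Multiset.coe_eq_coe.1 hβ⟩ hv, ?_⟩
      rw [List.flatMap_cons, NFA.evalFrom_append, NFA.mem_evalFrom_iff_exists]
      exact ⟨s, NFA.mem_evalFrom_iff_exists.2 ⟨r, hr, hs⟩, ht⟩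
    · rintro ⟨hw, v, hv, ht⟩
      obtain ⟨⟨h1, h2⟩, hw⟩ := List.forall_mem_cons.1 hw
      obtain _ | ⟨⟨hα, hβ⟩, hv⟩ := hv
      rename_i b v
      refine ⟨hw, v, hv, ?_⟩
      rw [List.flatMap_cons, NFA.evalFrom_append, NFA.mem_evalFrom_iff_exists] at ht
      obtain ⟨s, hs, ht⟩ := ht
      obtain ⟨r, hr, hs⟩ := NFA.mem_evalFrom_iff_exists.1 hs
      exact NFA.mem_evalFrom_iff_exists.2 ⟨s, NFA.mem_stepSet.2 ⟨r, hr, h1, h2, b.1, b.2,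
        Multiset.coe_eq_coe.2 hα, Multiset.coe_eq_coe.2 hβ, hs⟩, ht⟩

theorem permNFA_mem_accepts {I O S : Type*} (N : NFA (I × O) S) (k : ℕ)
    (w : List (List I × List O)) :
    w ∈ (permNFA N k).accepts ↔
      (∀ a ∈ w, a.1.length = k ∧ a.2.length = k) ∧
        ∃ v, BlockPerm w v ∧ (v.flatMap fun a => a.1.zip a.2) ∈ N.accepts := by
  have h (t : S) := permNFA_mem_evalFrom N k w N.start t
  constructor
  · rintro ⟨t, ht, he⟩
    obtain ⟨hw, v, hv, hm⟩ := (h t).1 he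
    exact ⟨hw, v, hv, t, ht, hm⟩
  · rintro ⟨hw, v, hv, t, ht, hm⟩
    exact ⟨t, ht, (h t).2 ⟨hw, v, hv, hm⟩⟩

theorem BlockPerm.length {I O : Type*} {k : ℕ} {w v : List (List I × List O)}
    (h : BlockPerm w v) (hw : ∀ a ∈ w, a.1.length = k ∧ a.2.length = k) :
    ∀ a ∈ v, a.1.length = k ∧ a.2.length = k := by
  induction h with
  | nil => exact hw
  | cons hab _ ih =>
    obtain ⟨⟨h1, h2⟩, hw⟩ := List.forall_mem_cons.1 hw
    exact List.forall_mem_cons.2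
      ⟨⟨hab.1.length_eq.trans h1, hab.2.length_eq.trans h2⟩, ih hw⟩

theorem map_fst_flatMap_zip {I O : Type*} {k : ℕ} {w : List (List I × List O)}
    (hw : ∀ a ∈ w, a.1.length = k ∧ a.2.length = k) :
    (w.flatMap fun a => a.1.zip a.2).map Prod.fst = w.flatMap Prod.fst := by
  rw [List.map_flatMap]
  refine List.flatMap_congr fun a ha => List.map_fst_zip ?_
  rw [(hw a ha).1, (hw a ha).2]

theorem map_snd_flatMap_zip {I O : Type*} {k : ℕ} {w : List (List I × List O)}
    (hw : ∀ a ∈ w, a.1.length = k ∧ a.2.length = k) :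
    (w.flatMap fun a => a.1.zip a.2).map Prod.snd = w.flatMap Prod.snd := by
  rw [List.map_flatMap]
  refine List.flatMap_congr fun a ha => List.map_snd_zip ?_
  rw [(hw a ha).1, (hw a ha).2]

theorem roundEquiv_append_left {α : Type*} {k : ℕ} {a x y : List α} (ha : a.length = k) :
    RoundEquiv k (a ++ x) y ↔
      ∃ b z, y = b ++ z ∧ b.Perm a ∧ RoundEquiv k x z := by
  constructor
  · rintro ⟨hl, hr⟩
    have hp : (y.take k).Perm a := by
      have := hr 0
      simp only [Nat.mul_zero, List.drop_zero, ← ha, List.take_left] at this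
      rw [← ha]
      exact (Multiset.coe_eq_coe.1 this).symm
    refine ⟨y.take k, y.drop k, (List.take_append_drop k y).symm, hp, ?_, fun r => ?_⟩
    · simp only [List.length_append, List.length_drop] at hl ⊢
      omega
    · have := hr (r + 1)
      rw [Nat.mul_succ, Nat.add_comm, ← List.drop_drop, ← List.drop_drop,
        List.drop_left' ha] at this
      exact this
  · rintro ⟨b, z, rfl, hb, hl, hr⟩
    have hbk : b.length = k := hb.length_eq.trans ha
    refine ⟨by simp [ha, hbk, hl], fun r => ?_⟩
    cases r with
    | zero =>
      simp only [Nat.mul_zero, List.drop_zero, List.take_left' ha, List.take_left' hbk]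
      exact Multiset.coe_eq_coe.2 hb.symm
    | succ r =>
      rw [Nat.mul_succ, Nat.add_comm, ← List.drop_drop, ← List.drop_drop,
        List.drop_left' ha, List.drop_left' hbk]
      exact hr r

theorem roundEquiv_nil_left {α : Type*} {k : ℕ} {y : List α} :
    RoundEquiv k [] y ↔ y = [] := by
  refine ⟨fun h => List.length_eq_zero_iff.1 h.1.symm, ?_⟩
  rintro rfl
  exact ⟨rfl, fun _ => rfl⟩

theorem roundEquiv_flatMap_iff {I O : Type*} {k : ℕ} {w : List (List I × List O)}
    (hw : ∀ a ∈ w, a.1.length = k ∧ a.2.length = k) {x : List I} {y : List O} :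
    RoundEquiv k (w.flatMap Prod.fst) x ∧ RoundEquiv k (w.flatMap Prod.snd) y ↔
      ∃ v, BlockPerm w v ∧ v.flatMap Prod.fst = x ∧ v.flatMap Prod.snd = y := by
  induction w generalizing x y with
  | nil => simp [roundEquiv_nil_left, BlockPerm, eq_comm]
  | cons a w ih =>
    obtain ⟨⟨h1, h2⟩, hw⟩ := List.forall_mem_cons.1 hw
    rw [List.flatMap_cons, List.flatMap_cons, roundEquiv_append_left h1,
      roundEquiv_append_left h2]
    constructor
    · rintro ⟨⟨b, x, rfl, hb, hx⟩, c, y, rfl, hc, hy⟩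
      obtain ⟨v, hv, rfl, rfl⟩ := (ih hw).1 ⟨hx, hy⟩
      exact ⟨(b, c) :: v, .cons ⟨hb, hc⟩ hv, rfl, rfl⟩
    · rintro ⟨_, ⟨⟩ | ⟨hb, hv⟩, rfl, rfl⟩
      obtain ⟨hx, hy⟩ := (ih hw).2 ⟨_, hv, rfl, rfl⟩
      exact ⟨⟨_, _, rfl, hb.1, hx⟩, _, _, rfl, hb.2, hy⟩

theorem exists_blocks {I O : Type*} {k m : ℕ} {x : List I} {y : List O}
    (hx : x.length = k * m) (hy : y.length = k * m) :
    ∃ w : List (List I × List O), (∀ a ∈ w, a.1.length = k ∧ a.2.length = k) ∧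
      w.flatMap Prod.fst = x ∧ w.flatMap Prod.snd = y := by
  induction m generalizing x y with
  | zero =>
    refine ⟨[], by simp, ?_, ?_⟩
    · exact (List.length_eq_zero_iff.1 hx).symm
    · exact (List.length_eq_zero_iff.1 hy).symm
  | succ m ih =>
    rw [Nat.mul_succ] at hx hy
    obtain ⟨w, hw, h1, h2⟩ := ih (x := x.drop k) (y := y.drop k)
      (by rw [List.length_drop]; omega) (by rw [List.length_drop]; omega)
    refine ⟨(x.take k, y.take k) :: w, List.forall_mem_cons.2 ⟨⟨?_, ?_⟩, hw⟩, ?_, ?_⟩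
    · rw [List.length_take]; omega
    · rw [List.length_take]; omega
    · rw [List.flatMap_cons, h1, List.take_append_drop]
    · rw [List.flatMap_cons, h2, List.take_append_drop]

namespace Transducer

variable {I O Q : Type*} (T : Transducer I O Q)

theorem length_outFrom (q : Q) (x : List I) : (T.outFrom q x).length = x.length := by
  induction x generalizing q with
  | nil => rfl
  | cons a x ih => simp [outFrom, ih]

theorem trace_evalFrom_none [DecidableEq O] (w : List (I × O)) :
    T.trace.evalFrom none w = none := by
  induction w with
  | nil => rfl
  | cons a w ih => exact ih

theorem trace_evalFrom_isSome [DecidableEq O] (q : Q) (w : List (I × O)) :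
    (T.trace.evalFrom (some q) w).isSome ↔
      T.outFrom q (w.map Prod.fst) = w.map Prod.snd := by
  induction w generalizing q with
  | nil => simp [outFrom]
  | cons a w ih =>
    have hstep : T.trace.step (some q) a =
        if T.label (T.step q a.1) = a.2 then some (T.step q a.1) else none := rfl
    rw [DFA.evalFrom_cons, hstep]
    split_ifs with h
    · simp [outFrom, ih, h]
    · simp [outFrom, trace_evalFrom_none, h]

theorem mem_trace_accepts [DecidableEq O] (w : List (I × O)) :
    w ∈ T.trace.toNFA.accepts ↔ T.out (w.map Prod.fst) = w.map Prod.snd := by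
  rw [DFA.toNFA_correct]
  exact T.trace_evalFrom_isSome T.init w

end Transducer

/-- `T₁ ≺_{k,Λ} T₂` iff `L(Perm_k(D₁)) ⊆ L(Perm_k(Tr(T₂)))`, where `D₁` is
any NFA recognizing `L(Tr(T₁)) ∩ Λ`. -/
theorem roundSim_iff_perm_containment {I O Q₁ Q₂ S : Type*} [DecidableEq O]
    (T₁ : Transducer I O Q₁) (T₂ : Transducer I O Q₂) (Λ : Set (List I)) (k : ℕ) (hk : 0 < k)
    (D₁ : NFA (I × O) S)
    (hD₁ : ∀ w : List (I × O),
      w ∈ D₁.accepts ↔ (T₁.out (w.map Prod.fst) = w.map Prod.snd ∧ w.map Prod.fst ∈ Λ)) :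
    RoundSim k T₁ T₂ Λ ↔
      (permNFA D₁ k).accepts ≤ (permNFA T₂.trace.toNFA k).accepts := by
  constructor
  · intro h w hw
    obtain ⟨hl, v, hwv, hv⟩ := (permNFA_mem_accepts D₁ k w).1 hw
    have hlv := hwv.length hl
    rw [hD₁, map_fst_flatMap_zip hlv, map_snd_flatMap_zip hlv] at hv
    obtain ⟨x', hx, hy⟩ := h _ hv.2 (by
      rw [List.length_flatMap]
      refine List.dvd_sum fun n hn => ?_
      obtain ⟨a, ha, rfl⟩ := List.mem_map.1 hn
      rw [(hlv a ha).1])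
    rw [hv.1] at hy
    obtain ⟨u, hvu, rfl, hu⟩ := (roundEquiv_flatMap_iff hlv).1 ⟨hx, hy⟩
    refine (permNFA_mem_accepts _ k w).2 ⟨hl, u, hwv.trans hvu, ?_⟩
    have hlu := hvu.length hlv
    rw [Transducer.mem_trace_accepts, map_fst_flatMap_zip hlu, map_snd_flatMap_zip hlu, hu]
  · rintro h x hx ⟨m, hm⟩
    obtain ⟨w, hl, rfl, hy⟩ :=
      exists_blocks (y := T₁.out x) hm ((T₁.length_outFrom _ x).trans hm)
    obtain ⟨-, v, hwv, hv⟩ := (permNFA_mem_accepts _ k w).1 <| h <|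
      (permNFA_mem_accepts D₁ k w).2 ⟨hl, w, .refl w, by
        rw [hD₁, map_fst_flatMap_zip hl, map_snd_flatMap_zip hl]
        exact ⟨hy.symm, hx⟩⟩
    have hlv := hwv.length hl
    rw [Transducer.mem_trace_accepts, map_fst_flatMap_zip hlv, map_snd_flatMap_zip hlv] at hv
    rw [← hy]
    exact ⟨_, (roundEquiv_flatMap_iff hl).2 ⟨v, hwv, rfl, hv.symm⟩⟩
end

section
/- The language of the permutation-closure NFA depends only on the language of the underlying NFA: if N and N' are NFAs over the alphabet Σ_I×Σ_O with L(N) = L(N'), then for every k > 0, L(Perm_k(N)) = L(Perm_k(N')). -/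
/-- `w` is an interleaving of permutations of the two blocks of `a`, both of length `k`. -/
def IsBlockWord {I O : Type*} (k : ℕ) (a : List I × List O) (w : List (I × O)) : Prop :=
  a.1.length = k ∧ a.2.length = k ∧
    ∃ (α : List I) (β : List O), (↑α : Multiset I) = ↑a.1 ∧ (↑β : Multiset O) = ↑a.2 ∧
      w = α.zip β

theorem mem_permNFA_stepSet {I O S : Type*} (N : NFA (I × O) S) (k : ℕ) (T : Set S)
    (a : List I × List O) (t : S) :
    t ∈ (permNFA N k).stepSet T a ↔ ∃ w, IsBlockWord k a w ∧ t ∈ N.evalFrom T w := by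
  rw [NFA.mem_stepSet]
  constructor
  · rintro ⟨s, hs, h₁, h₂, α, β, hα, hβ, ht⟩
    exact ⟨_, ⟨h₁, h₂, α, β, hα, hβ, rfl⟩,
      (NFA.mem_evalFrom_iff_exists (M := N)).2 ⟨s, hs, ht⟩⟩
  · rintro ⟨_, ⟨h₁, h₂, α, β, hα, hβ, rfl⟩, ht⟩
    obtain ⟨s, hs, hst⟩ := (NFA.mem_evalFrom_iff_exists (M := N)).1 ht
    exact ⟨s, hs, h₁, h₂, α, β, hα, hβ, hst⟩

theorem mem_permNFA_evalFrom {I O S : Type*} (N : NFA (I × O) S) (k : ℕ) (T : Set S)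
    (x : List (List I × List O)) (t : S) :
    t ∈ (permNFA N k).evalFrom T x ↔
      ∃ ws, List.Forall₂ (IsBlockWord k) x ws ∧ t ∈ N.evalFrom T ws.flatten := by
  induction x generalizing T with
  | nil => simp
  | cons a x ih =>
    rw [NFA.evalFrom_cons, ih]
    constructor
    · rintro ⟨ws, hws, ht⟩
      obtain ⟨s, hs, hst⟩ := (NFA.mem_evalFrom_iff_exists (M := N)).1 ht
      obtain ⟨w, hw, hsw⟩ := (mem_permNFA_stepSet N k T a s).1 hs
      refine ⟨w :: ws, .cons hw hws, ?_⟩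
      rw [List.flatten_cons, NFA.evalFrom_append]
      exact (NFA.mem_evalFrom_iff_exists (M := N)).2 ⟨s, hsw, hst⟩
    · rintro ⟨_, @⟨⟩ | @⟨_, w, _, ws, hw, hws⟩, ht⟩
      rw [List.flatten_cons, NFA.evalFrom_append] at ht
      obtain ⟨s, hs, hst⟩ := (NFA.mem_evalFrom_iff_exists (M := N)).1 ht
      exact ⟨ws, hws, (NFA.mem_evalFrom_iff_exists (M := N)).2
        ⟨s, (mem_permNFA_stepSet N k T a s).2 ⟨w, hw, hs⟩, hst⟩⟩

/-- A word is accepted by `permNFA N k` iff permuting its blocks yields a word of `N.accepts`. -/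
theorem mem_permNFA_accepts {I O S : Type*} (N : NFA (I × O) S) (k : ℕ)
    (x : List (List I × List O)) :
    x ∈ (permNFA N k).accepts ↔
      ∃ ws, List.Forall₂ (IsBlockWord k) x ws ∧ ws.flatten ∈ N.accepts := by
  constructor
  · rintro ⟨t, ht, hx⟩
    obtain ⟨ws, hws, h⟩ := (mem_permNFA_evalFrom N k N.start x t).1 hx
    exact ⟨ws, hws, t, ht, h⟩
  · rintro ⟨ws, hws, t, ht, h⟩
    exact ⟨t, ht, (mem_permNFA_evalFrom N k N.start x t).2 ⟨ws, hws, h⟩⟩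

/-- the language of the permutation-closure NFA depends only on the language
of the underlying NFA. -/
theorem permNFA_accepts_congr {I O S S' : Type*} (N : NFA (I × O) S) (N' : NFA (I × O) S')
    (h : N.accepts = N'.accepts) (k : ℕ) (hk : 0 < k) :
    (permNFA N k).accepts = (permNFA N' k).accepts := by
  ext x
  rw [mem_permNFA_accepts, mem_permNFA_accepts, h]
end

section
/- Let B1 and B2 be NFAs over the finite alphabet Σ_I×Σ_O that have the same state set, the same initial state, and the same transition function, and differ only in their sets of accepting states. Let k, k' > 0 be such that Υ(B1,k) = Υ(B1,k'). Then L(Perm_k(B1)) ⊆ L(Perm_k(B2)) if and only if L(Perm_{k'}(B1)) ⊆ L(Perm_{k'}(B2)). -/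
/-- A letter acts in `Perm_k(N)` through the type of its Parikh vectors. -/
theorem permNFA_step_eq_vecType {I O S : Type*} (N : NFA (I × O) S) (k : ℕ)
    (a : List I × List O) (s : S) :
    (permNFA N k).step s a = {t | vecType N k ↑a.1 ↑a.2 s t} := by
  ext t
  change (a.1.length = k ∧ a.2.length = k ∧ _) ↔
    ((a.1 : Multiset I).toList.length = k ∧ (a.2 : Multiset O).toList.length = k ∧ _)
  simp only [Multiset.length_toList, Multiset.coe_card, Multiset.coe_toList]

/-- In the presence of a run, a word over the letters of `Perm_k(N)` can be replaced by a word
over the letters of `Perm_k'(N)` with the same effect, if the `k`-th type profile is contained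
in the `k'`-th one. -/
theorem exists_permNFA_evalFrom_eq {I O S : Type*} (N : NFA (I × O) S) {k k' : ℕ}
    (hprof : typeProfile N k ⊆ typeProfile N k') (w : List (List I × List O)) (A : Set S)
    (hne : ((permNFA N k).evalFrom A w).Nonempty) :
    ∃ w', (permNFA N k').evalFrom A w' = (permNFA N k).evalFrom A w := by
  induction w generalizing A with
  | nil => exact ⟨[], rfl⟩
  | cons a w ih =>
    rw [NFA.evalFrom_cons] at hne ⊢
    obtain ⟨w', hw'⟩ := ih _ hne
    have hlen : a.1.length = k ∧ a.2.length = k := by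
      by_contra h
      have hA : (permNFA N k).stepSet A a = ∅ := by
        ext t
        simp only [NFA.mem_stepSet, permNFA, Set.mem_ofPred_eq, Set.mem_empty_iff_false, iff_false]
        rintro ⟨s, -, h₁, h₂, -⟩
        exact h ⟨h₁, h₂⟩
      simp [hA, NFA.evalFrom_eq_biUnion_singleton (S := ∅)] at hne
    obtain ⟨p, o, -, -, hτ⟩ := hprof
      ⟨↑a.1, ↑a.2, by simpa using hlen.1, by simpa using hlen.2, rfl⟩
    refine ⟨(p.toList, o.toList) :: w', ?_⟩
    have hstep : (permNFA N k').stepSet A (p.toList, o.toList) = (permNFA N k).stepSet A a := by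
      ext t
      simp only [NFA.mem_stepSet]
      refine exists_congr fun s => and_congr_right fun _ => ?_
      rw [permNFA_step_eq_vecType N k a, ← hτ]
      rfl
    rw [NFA.evalFrom_cons, hstep, hw']

/-- Containment between permutation closures transfers along inclusion of type profiles. -/
theorem permNFA_accepts_le_of_typeProfile_subset {I O S : Type*}
    (step : S → I × O → Set S) (start : Set S) (F₁ F₂ : Set S) {k k' : ℕ}
    (hprof : typeProfile (⟨step, start, F₁⟩ : NFA (I × O) S) k
           ⊆ typeProfile (⟨step, start, F₁⟩ : NFA (I × O) S) k')
    (hle : (permNFA (⟨step, start, F₁⟩ : NFA (I × O) S) k').accepts ≤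
        (permNFA (⟨step, start, F₂⟩ : NFA (I × O) S) k').accepts) :
    (permNFA (⟨step, start, F₁⟩ : NFA (I × O) S) k).accepts ≤
      (permNFA (⟨step, start, F₂⟩ : NFA (I × O) S) k).accepts := by
  rintro w ⟨s, hs, hw⟩
  obtain ⟨w', hw'⟩ := exists_permNFA_evalFrom_eq _ hprof w start ⟨s, hw⟩
  obtain ⟨t, ht, htw⟩ := hle (a := w') ⟨s, hs, hw'.ge hw⟩
  exact ⟨t, ht, hw'.le htw⟩

/-- for NFAs `B₁`, `B₂` differing only in their accepting states, if
`Υ(B₁,k) = Υ(B₁,k')` then `L(Perm_k(B₁)) ⊆ L(Perm_k(B₂))` iff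
`L(Perm_{k'}(B₁)) ⊆ L(Perm_{k'}(B₂))`. -/
theorem profile_equality_to_containment {I O S : Type*}
    (step : S → I × O → Set S) (start : Set S) (F₁ F₂ : Set S)
    (k k' : ℕ) (hk : 0 < k) (hk' : 0 < k')
    (hprof : typeProfile (⟨step, start, F₁⟩ : NFA (I × O) S) k
           = typeProfile (⟨step, start, F₁⟩ : NFA (I × O) S) k') :
    ((permNFA (⟨step, start, F₁⟩ : NFA (I × O) S) k).accepts ≤
        (permNFA (⟨step, start, F₂⟩ : NFA (I × O) S) k).accepts ↔
      (permNFA (⟨step, start, F₁⟩ : NFA (I × O) S) k').accepts ≤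
        (permNFA (⟨step, start, F₂⟩ : NFA (I × O) S) k').accepts) := by
  exact ⟨permNFA_accepts_le_of_typeProfile_subset step start F₁ F₂ hprof.ge,
    permNFA_accepts_le_of_typeProfile_subset step start F₁ F₂ hprof.le⟩
end

section
/- Closure of round symmetry under composition: let T be a 2^P/2^P transducer, k > 0, and π, χ permutations of the finite set P. If T^π ≺_k T and T^χ ≺_k T, then T^{π∘χ} ≺_k T. -/
theorem RoundEquiv.trans {α : Type*} {k : ℕ} {x y z : List α}
    (hxy : RoundEquiv k x y) (hyz : RoundEquiv k y z) : RoundEquiv k x z :=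
  ⟨hxy.1.trans hyz.1, fun r => (hxy.2 r).trans (hyz.2 r)⟩

theorem RoundEquiv.map {α β : Type*} {k : ℕ} {x y : List α} (f : α → β)
    (h : RoundEquiv k x y) : RoundEquiv k (x.map f) (y.map f) := by
  refine ⟨by simpa using h.1, fun r => ?_⟩
  rw [← List.map_drop, ← List.map_take, ← List.map_drop, ← List.map_take,
    ← Multiset.map_coe, ← Multiset.map_coe, h.2 r]

theorem permuteWord_mul {P : Type*} (π χ : Equiv.Perm P) (x : List (Set P)) :
    permuteWord (π * χ) x = permuteWord π (permuteWord χ x) := by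
  simp [permuteWord, Equiv.Perm.coe_mul, Set.image_comp]

theorem permuteWord_one {P : Type*} (x : List (Set P)) : permuteWord 1 x = x := by
  simp [permuteWord]

namespace Transducer

variable {P Q : Type*}

theorem outFrom_permuted (T : Transducer (Set P) (Set P) Q) (π : Equiv.Perm P)
    (q : Q) (x : List (Set P)) :
    (T.permuted π).outFrom q x = permuteWord π (T.outFrom q (permuteWord π⁻¹ x)) := by
  induction x generalizing q with
  | nil => rfl
  | cons a x ih => exact congrArg _ (ih _)

theorem out_permuted (T : Transducer (Set P) (Set P) Q) (π : Equiv.Perm P)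
    (x : List (Set P)) :
    (T.permuted π).out x = permuteWord π (T.out (permuteWord π⁻¹ x)) :=
  T.outFrom_permuted π T.init x

end Transducer

/-- closure under composition: if `T^π ≺_k T` and `T^χ ≺_k T` then
`T^{π∘χ} ≺_k T`. -/
theorem sim_comp {P Q : Type*} [Fintype P] (T : Transducer (Set P) (Set P) Q)
    (k : ℕ) (hk : 0 < k) (π χ : Equiv.Perm P)
    (hπ : RoundSim k (T.permuted π) T Set.univ)
    (hχ : RoundSim k (T.permuted χ) T Set.univ) :
    RoundSim k (T.permuted (π * χ)) T Set.univ := by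
  intro x _ hx
  obtain ⟨y, hy, hTy⟩ := hχ (permuteWord π⁻¹ x) trivial (by simpa [permuteWord] using hx)
  have hxy : RoundEquiv k x (permuteWord π y) := by
    have h : RoundEquiv k (permuteWord π (permuteWord π⁻¹ x)) (permuteWord π y) := hy.map _
    rwa [← permuteWord_mul, mul_inv_cancel, permuteWord_one] at h
  obtain ⟨z, hz, hTz⟩ := hπ (permuteWord π y) trivial (hxy.1 ▸ hx)
  refine ⟨z, hxy.trans hz, ?_⟩
  rw [T.out_permuted, ← permuteWord_mul, inv_mul_cancel, permuteWord_one] at hTz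
  rw [T.out_permuted] at hTy ⊢
  rw [mul_inv_rev, permuteWord_mul, permuteWord_mul]
  exact RoundEquiv.trans (hTy.map _) hTz
end
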